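/- The function defined by f(z) = 2i·arccos x₀ - 2·Log φ(z) for Im z > 0 and f(z) = 2i·arccos x₀ + 2·Log φ(z) for Im z < 0 (Log the principal logarithm) extends to a function holomorphic on ℂ∖((-∞,-1]∪[1,∞)); this extension satisfies f(x) = 2i·(arccos x₀ - arccos x) for every x ∈ (-1,1), its derivative at x₀ is f'(x₀) = 2i/√(1-x₀²) (so f(z) = (2i/√(1-x₀²))(z-x₀) + O((z-x₀)²) as z → x₀), and f maps (-1,x₀) bijectively onto the purely imaginary interval (2i(arccos x₀ - π), 0) and maps (x₀,1) bijectively onto (0, 2i·arccos x₀). -/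

import Mathlib

noncomputable section

open Filter Set

/-- The segment `[-1,1]` viewed as a subset of `ℂ`. -/
def seg : Set ℂ := {z : ℂ | z.im = 0 ∧ -1 ≤ z.re ∧ z.re ≤ 1}

/-- The plane cut along the two rays `(-∞,-1]` and `[1,∞)`. -/
def cutPlane : Set ℂ := {z : ℂ | ¬(z.im = 0 ∧ (z.re ≤ -1 ∨ 1 ≤ z.re))}

/-- The principal branch of `√(1-z²)`, holomorphic on `cutPlane`. -/
def sqrtOneSubSq (z : ℂ) : ℂ := (1 - z ^ 2) ^ (1 / 2 : ℂ)

/-- The continuation of `φ` from the upper half-plane across `(-1,1)`. -/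
def joukowskyInv (z : ℂ) : ℂ := z + Complex.I * sqrtOneSubSq z

lemma sqrtOneSubSq_sq (z : ℂ) : sqrtOneSubSq z ^ 2 = 1 - z ^ 2 := by
  simp [sqrtOneSubSq]

lemma joukowskyInv_mul (z : ℂ) :
    joukowskyInv z * (z - Complex.I * sqrtOneSubSq z) = 1 := by
  have h := sqrtOneSubSq_sq z
  unfold joukowskyInv
  linear_combination h - sqrtOneSubSq z ^ 2 * Complex.I_sq

lemma joukowskyInv_ne_zero (z : ℂ) : joukowskyInv z ≠ 0 :=
  left_ne_zero_of_mul_eq_one (joukowskyInv_mul z)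

lemma mem_cutPlane_of_im_ne_zero {z : ℂ} (hz : z.im ≠ 0) : z ∈ cutPlane :=
  fun h => hz h.1

lemma ofReal_mem_cutPlane {x : ℝ} (hx : x ∈ Set.Ioo (-1 : ℝ) 1) : (x : ℂ) ∈ cutPlane := by
  rintro ⟨-, h | h⟩
  · exact absurd hx.1 (not_lt.2 h)
  · exact absurd hx.2 (not_lt.2 h)

lemma isOpen_cutPlane : IsOpen cutPlane := by
  have h : IsClosed {z : ℂ | z.im = 0 ∧ (z.re ≤ -1 ∨ 1 ≤ z.re)} :=
    (isClosed_eq Complex.continuous_im continuous_const).inter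
      ((isClosed_le Complex.continuous_re continuous_const).union
        (isClosed_le continuous_const Complex.continuous_re))
  exact h.isOpen_compl

lemma one_sub_sq_mem_slitPlane {z : ℂ} (hz : z ∈ cutPlane) :
    1 - z ^ 2 ∈ Complex.slitPlane := by
  rw [Complex.mem_slitPlane_iff]
  by_contra! h
  obtain ⟨h1, h2⟩ := h
  simp only [pow_two, Complex.sub_re, Complex.sub_im, Complex.mul_re, Complex.mul_im,
    Complex.one_re, Complex.one_im] at h1 h2
  have h3 : z.re * z.im = 0 := by linarith
  rcases mul_eq_zero.1 h3 with h4 | h4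
  · rw [h4] at h1
    nlinarith [sq_nonneg z.im]
  · refine hz ⟨h4, ?_⟩
    rw [h4] at h1
    by_contra! h5
    nlinarith

lemma sqrtOneSubSq_ne_zero {z : ℂ} (hz : z ∈ cutPlane) : sqrtOneSubSq z ≠ 0 := by
  intro h
  have h1 := sqrtOneSubSq_sq z
  rw [h] at h1
  exact Complex.slitPlane_ne_zero (one_sub_sq_mem_slitPlane hz) (by rw [← h1]; ring)

lemma joukowskyInv_mem_slitPlane {z : ℂ} (hz : z ∈ cutPlane) :
    joukowskyInv z ∈ Complex.slitPlane := by
  by_contra h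
  rw [Complex.mem_slitPlane_iff] at h
  push Not at h
  obtain ⟨h1, h2⟩ := h
  obtain ⟨t, ht⟩ : ∃ t : ℝ, joukowskyInv z = (t : ℂ) :=
    ⟨(joukowskyInv z).re, Complex.ext rfl (by simpa using h2)⟩
  have ht0 : t ≠ 0 := by
    rintro rfl
    exact joukowskyInv_ne_zero z (by simpa using ht)
  have htneg : t < 0 := lt_of_le_of_ne (by simpa [ht] using h1) ht0
  have hm := joukowskyInv_mul z
  have htc : (t : ℂ) ≠ 0 := by exact_mod_cast ht0
  have hz2 : z = (((t + t⁻¹) / 2 : ℝ) : ℂ) := by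
    have h3 : z - Complex.I * sqrtOneSubSq z = (t : ℂ)⁻¹ := by
      rw [ht] at hm
      exact eq_inv_of_mul_eq_one_right hm
    have h4 : z + Complex.I * sqrtOneSubSq z = (t : ℂ) := ht
    push_cast
    linear_combination (h3 + h4) / 2
  apply hz
  rw [hz2]
  refine ⟨Complex.ofReal_im _, Or.inl ?_⟩
  rw [Complex.ofReal_re]
  have h5 : t * t⁻¹ = 1 := mul_inv_cancel₀ ht0
  have h6 : t⁻¹ < 0 := inv_lt_zero.2 htneg
  nlinarith [sq_nonneg (t - t⁻¹)]

lemma hasDerivAt_sqrtOneSubSq {z : ℂ} (hz : z ∈ cutPlane) :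
    HasDerivAt sqrtOneSubSq (-z / sqrtOneSubSq z) z := by
  have h1 : HasDerivAt (fun w : ℂ => 1 - w ^ 2) (-(2 * z)) z := by
    simpa using (hasDerivAt_pow 2 z).const_sub 1
  have h2 := h1.cpow_const (c := (1 / 2 : ℂ)) (one_sub_sq_mem_slitPlane hz)
  have h3 : (1 - z ^ 2 : ℂ) ^ ((1 / 2 : ℂ) - 1) = (sqrtOneSubSq z)⁻¹ := by
    rw [sqrtOneSubSq, ← Complex.cpow_neg]
    norm_num
  rw [h3] at h2
  exact h2.congr_deriv (by ring)

lemma hasDerivAt_log_joukowskyInv {z : ℂ} (hz : z ∈ cutPlane) :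
    HasDerivAt (fun w => Complex.log (joukowskyInv w)) (-Complex.I / sqrtOneSubSq z) z := by
  have h1 : HasDerivAt joukowskyInv (1 + Complex.I * (-z / sqrtOneSubSq z)) z :=
    (hasDerivAt_id z).add ((hasDerivAt_sqrtOneSubSq hz).const_mul Complex.I)
  convert h1.clog (joukowskyInv_mem_slitPlane hz) using 1
  have h2 := sqrtOneSubSq_ne_zero hz
  rw [eq_div_iff (joukowskyInv_ne_zero z)]
  field_simp
  unfold joukowskyInv
  linear_combination -sqrtOneSubSq z * Complex.I_sq

lemma sqrtOneSubSq_of_nonneg {z : ℂ} {r : ℝ} (hr : 0 ≤ r) (h : 1 - z ^ 2 = (r : ℂ)) :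
    sqrtOneSubSq z = (Real.sqrt r : ℂ) := by
  rw [sqrtOneSubSq, h, Real.sqrt_eq_rpow, Complex.ofReal_cpow hr]
  norm_num

lemma sqrtOneSubSq_ofReal {x : ℝ} (hx : x ∈ Set.Ioo (-1 : ℝ) 1) :
    sqrtOneSubSq (x : ℂ) = (Real.sqrt (1 - x ^ 2) : ℂ) :=
  sqrtOneSubSq_of_nonneg (by nlinarith [hx.1, hx.2]) (by push_cast; ring)

lemma log_joukowskyInv_ofReal {x : ℝ} (hx : x ∈ Set.Ioo (-1 : ℝ) 1) :
    Complex.log (joukowskyInv (x : ℂ)) = (Real.arccos x : ℂ) * Complex.I := by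
  have h : joukowskyInv (x : ℂ) = Complex.exp ((Real.arccos x : ℂ) * Complex.I) := by
    rw [Complex.exp_mul_I, ← Complex.ofReal_cos, ← Complex.ofReal_sin,
      Real.cos_arccos hx.1.le hx.2.le, Real.sin_arccos, joukowskyInv, sqrtOneSubSq_ofReal hx]
    ring
  rw [h, Complex.log_exp]
  · simpa using (neg_lt_zero.2 Real.pi_pos).trans_le (Real.arccos_nonneg x)
  · simpa using Real.arccos_le_pi x

/-- On a half-plane, a square root of `z²-1` is determined up to a global sign. -/
lemma eq_or_eq_neg_of_sq_eq_sq_sub_one {U : Set ℂ} (hU : IsPreconnected U)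
    (him : ∀ z ∈ U, z.im ≠ 0) {s : ℂ → ℂ} (hs : ContinuousOn s U)
    (hs2 : ∀ z ∈ U, s z ^ 2 = z ^ 2 - 1) :
    EqOn s (fun z => Complex.I * sqrtOneSubSq z) U ∨
      EqOn s (-fun z => Complex.I * sqrtOneSubSq z) U := by
  refine hU.eq_or_eq_neg_of_sq_eq hs ?_ ?_ ?_
  · intro z hz
    exact ((hasDerivAt_sqrtOneSubSq
      (mem_cutPlane_of_im_ne_zero (him z hz))).continuousAt.const_mul
        Complex.I).continuousWithinAt
  · intro z hz
    simp only [Pi.pow_apply, mul_pow, Complex.I_sq, sqrtOneSubSq_sq, hs2 z hz]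
    ring
  · intro z hz
    exact mul_ne_zero Complex.I_ne_zero
      (sqrtOneSubSq_ne_zero (mem_cutPlane_of_im_ne_zero (him z hz)))

/-- The value of the principal branch along the imaginary axis rules out the wrong sign. -/
lemma not_forall_eq_mul_I_sqrt {s : ℂ → ℂ}
    (hsinf : Tendsto (fun z => s z / z) (Bornology.cobounded ℂ) (nhds 1))
    {ε : ℝ} (hε : ε = 1 ∨ ε = -1)
    (h : ∀ y : ℝ, 0 < y →
      s ((ε * y : ℝ) * Complex.I) =
        -(ε : ℂ) * (Complex.I * sqrtOneSubSq ((ε * y : ℝ) * Complex.I))) : False := by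
  have hε2 : ε ^ 2 = 1 := by rcases hε with rfl | rfl <;> norm_num
  have hε0 : ε ≠ 0 := by rintro rfl; norm_num at hε2
  have hεabs : |ε| = 1 := by rcases hε with rfl | rfl <;> norm_num
  have ht : Tendsto (fun y : ℝ => ((ε * y : ℝ) : ℂ) * Complex.I) atTop
      (Bornology.cobounded ℂ) := by
    rw [← tendsto_norm_atTop_iff_cobounded]
    simpa [abs_mul, hεabs] using tendsto_abs_atTop_atTop
  have h1 := (Complex.continuous_re.tendsto _).comp (hsinf.comp ht)
  have h2 : ∀ᶠ y : ℝ in atTop,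
      (Complex.re ∘ (fun z => s z / z) ∘ fun y : ℝ => ((ε * y : ℝ) : ℂ) * Complex.I) y ≤ 0 := by
    filter_upwards [eventually_gt_atTop 0] with y hy
    have hv : sqrtOneSubSq (((ε * y : ℝ) : ℂ) * Complex.I) = (Real.sqrt (1 + y ^ 2) : ℂ) := by
      refine sqrtOneSubSq_of_nonneg (by positivity) ?_
      have hc : (ε : ℂ) ^ 2 = 1 := by exact_mod_cast hε2
      push_cast
      linear_combination -(ε : ℂ) ^ 2 * (y : ℂ) ^ 2 * Complex.I_sq + (y : ℂ) ^ 2 * hc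
    have he : s (((ε * y : ℝ) : ℂ) * Complex.I) / (((ε * y : ℝ) : ℂ) * Complex.I) =
        ((-(Real.sqrt (1 + y ^ 2) / y) : ℝ) : ℂ) := by
      rw [h y hy, hv]
      have hyc : (y : ℂ) ≠ 0 := by exact_mod_cast hy.ne'
      have hec : (ε : ℂ) ≠ 0 := by exact_mod_cast hε0
      push_cast
      field_simp
    simp only [Function.comp_apply, he, Complex.ofReal_re, Left.neg_nonpos_iff]
    positivity
  have h3 := le_of_tendsto h1 h2
  norm_num at h3

lemma not_mem_seg_of_im_ne_zero {z : ℂ} (hz : z.im ≠ 0) : z ∉ seg := fun h => hz h.1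

lemma branch_eq_of_im_pos {s : ℂ → ℂ} (hs : DifferentiableOn ℂ s segᶜ)
    (hs2 : ∀ z ∉ seg, s z ^ 2 = z ^ 2 - 1)
    (hsinf : Tendsto (fun z => s z / z) (Bornology.cobounded ℂ) (nhds 1))
    {z : ℂ} (hz : 0 < z.im) : s z = Complex.I * sqrtOneSubSq z := by
  have him : ∀ z ∈ {z : ℂ | 0 < z.im}, z.im ≠ 0 := fun z hz => ne_of_gt hz
  rcases eq_or_eq_neg_of_sq_eq_sq_sub_one (convex_halfSpace_im_gt 0).isPreconnected him
    (hs.continuousOn.mono fun z hz => not_mem_seg_of_im_ne_zero (him z hz))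
    (fun z hz => hs2 z (not_mem_seg_of_im_ne_zero (him z hz))) with h | h
  · exact h hz
  · refine (not_forall_eq_mul_I_sqrt hsinf (Or.inl rfl) fun y hy => ?_).elim
    have hmem : ((1 * y : ℝ) : ℂ) * Complex.I ∈ {z : ℂ | 0 < z.im} := by simpa using hy
    simpa using h hmem

lemma branch_eq_of_im_neg {s : ℂ → ℂ} (hs : DifferentiableOn ℂ s segᶜ)
    (hs2 : ∀ z ∉ seg, s z ^ 2 = z ^ 2 - 1)
    (hsinf : Tendsto (fun z => s z / z) (Bornology.cobounded ℂ) (nhds 1))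
    {z : ℂ} (hz : z.im < 0) : s z = -(Complex.I * sqrtOneSubSq z) := by
  have him : ∀ z ∈ {z : ℂ | z.im < 0}, z.im ≠ 0 := fun z hz => ne_of_lt hz
  rcases eq_or_eq_neg_of_sq_eq_sq_sub_one (convex_halfSpace_im_lt 0).isPreconnected him
    (hs.continuousOn.mono fun z hz => not_mem_seg_of_im_ne_zero (him z hz))
    (fun z hz => hs2 z (not_mem_seg_of_im_ne_zero (him z hz))) with h | h
  · refine (not_forall_eq_mul_I_sqrt hsinf (Or.inr rfl) fun y hy => ?_).elim
    have hmem : ((-1 * y : ℝ) : ℂ) * Complex.I ∈ {z : ℂ | z.im < 0} := by simpa using hy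
    simpa using h hmem
  · exact h hz

/-- First order Taylor expansion of a holomorphic function with quadratic remainder. -/
lemma isBigO_sub_sub_deriv_mul {g : ℂ → ℂ} {U : Set ℂ} (hU : IsOpen U)
    (hg : DifferentiableOn ℂ g U) {a c : ℂ} (ha : a ∈ U) (hc : HasDerivAt g c a) :
    (fun z => g z - g a - c * (z - a)) =O[nhds a] (fun z => (z - a) ^ 2) := by
  have hd : DifferentiableAt ℂ (dslope g a) a :=
    ((Complex.differentiableOn_dslope (hU.mem_nhds ha)).2 hg).differentiableAt (hU.mem_nhds ha)
  have h := (Asymptotics.isBigO_refl (fun z : ℂ => z - a) (nhds a)).mul hd.isBigO_sub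
  refine (h.congr (fun z => ?_) fun z => ?_)
  · have h1 := sub_smul_dslope g a z
    rw [smul_eq_mul] at h1
    rw [dslope_same, hc.deriv]
    linear_combination h1
  · ring

/-- A function equal to `2i(arccos x₀ - arccos x)` on `(a,b) ⊆ [-1,1]` maps it bijectively onto
the corresponding imaginary interval. -/
lemma bijOn_of_eq_arccos {g : ℂ → ℂ} {A a b : ℝ} (ha : -1 ≤ a) (hb : b ≤ 1) (hab : a ≤ b)
    (hg : ∀ x ∈ Set.Ioo a b, g (x : ℂ) = 2 * Complex.I * ((A - Real.arccos x : ℝ) : ℂ)) :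
    Set.BijOn g ((fun t : ℝ => (t : ℂ)) '' Set.Ioo a b)
      ((fun t : ℝ => 2 * Complex.I * (t : ℂ)) ''
        Set.Ioo (A - Real.arccos a) (A - Real.arccos b)) := by
  refine ⟨?_, ?_, ?_⟩
  · rintro _ ⟨x, hx, rfl⟩
    refine ⟨A - Real.arccos x, ⟨?_, ?_⟩, (hg x hx).symm⟩
    · have := Real.arccos_lt_arccos ha hx.1 (hx.2.le.trans hb)
      linarith
    · have := Real.arccos_lt_arccos (ha.trans hx.1.le) hx.2 hb
      linarith
  · rintro _ ⟨x, hx, rfl⟩ _ ⟨y, hy, rfl⟩ hxy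
    simp only [hg x hx, hg y hy] at hxy
    have h1 := mul_left_cancel₀ (mul_ne_zero two_ne_zero Complex.I_ne_zero) hxy
    have h2 : Real.arccos x = Real.arccos y := by
      have := Complex.ofReal_injective h1
      linarith
    have h3 : x = y := Real.arccos_injOn ⟨ha.trans hx.1.le, hx.2.le.trans hb⟩
      ⟨ha.trans hy.1.le, hy.2.le.trans hb⟩ h2
    rw [h3]
  · rintro _ ⟨t, ht, rfl⟩
    have h0 := Real.arccos_nonneg b
    have hpi := Real.arccos_le_pi a
    have hac : Real.arccos (Real.cos (A - t)) = A - t :=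
      Real.arccos_cos (by linarith [ht.2]) (by linarith [ht.1])
    have hx : Real.cos (A - t) ∈ Set.Ioo a b := by
      constructor
      · rw [← Real.cos_arccos ha (hab.trans hb)]
        exact Real.cos_lt_cos_of_nonneg_of_le_pi (by linarith [ht.2]) hpi (by linarith [ht.1])
      · rw [← Real.cos_arccos (ha.trans hab) hb]
        exact Real.cos_lt_cos_of_nonneg_of_le_pi h0 (by linarith [ht.1]) (by linarith [ht.2])
    refine ⟨_, ⟨_, hx, rfl⟩, ?_⟩
    simp only [hg _ hx, hac, sub_sub_cancel]

theorem conformal_map_f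
    (x₀ : ℝ) (hx₀ : x₀ ∈ Set.Ioo (-1 : ℝ) 1)
    -- the branch of `√(z²-1)` holomorphic in `ℂ∖[-1,1]` with `√(z²-1)/z → 1` at `∞`
    (s : ℂ → ℂ)
    (hs : DifferentiableOn ℂ s segᶜ)
    (hs2 : ∀ z ∉ seg, (s z) ^ 2 = z ^ 2 - 1)
    (hsinf : Filter.Tendsto (fun z => s z / z) (Bornology.cobounded ℂ) (nhds 1))
    -- `f(z) = 2i·arccos x₀ ∓ 2·Log φ(z)` for `± Im z > 0`, with `φ(z) = z + √(z²-1)`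
    (F : ℂ → ℂ)
    (hFup : ∀ z : ℂ, 0 < z.im →
      F z = 2 * Complex.I * (Real.arccos x₀ : ℂ) - 2 * Complex.log (z + s z))
    (hFdown : ∀ z : ℂ, z.im < 0 →
      F z = 2 * Complex.I * (Real.arccos x₀ : ℂ) + 2 * Complex.log (z + s z)) :
    ∃ g : ℂ → ℂ,
      -- `g` is a holomorphic extension of `F` to `ℂ∖((-∞,-1]∪[1,∞))`
      (∀ z : ℂ, z.im ≠ 0 → g z = F z) ∧
      DifferentiableOn ℂ g {z : ℂ | ¬(z.im = 0 ∧ (z.re ≤ -1 ∨ 1 ≤ z.re))} ∧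
      -- values on `(-1,1)`
      (∀ x ∈ Set.Ioo (-1 : ℝ) 1,
        g (x : ℂ) = 2 * Complex.I * ((Real.arccos x₀ - Real.arccos x : ℝ) : ℂ)) ∧
      -- derivative at `x₀`
      HasDerivAt g (2 * Complex.I / ((Real.sqrt (1 - x₀ ^ 2) : ℝ) : ℂ)) (x₀ : ℂ) ∧
      -- `g(z) = (2i/√(1-x₀²))(z-x₀) + O((z-x₀)²)` as `z → x₀`
      (fun z : ℂ => g z - 2 * Complex.I / ((Real.sqrt (1 - x₀ ^ 2) : ℝ) : ℂ) * (z - (x₀ : ℂ)))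
        =O[nhds (x₀ : ℂ)] (fun z : ℂ => (z - (x₀ : ℂ)) ^ 2) ∧
      -- `g` maps `(-1,x₀)` bijectively onto `(2i(arccos x₀ - π), 0)`
      Set.BijOn g ((fun t : ℝ => (t : ℂ)) '' Set.Ioo (-1 : ℝ) x₀)
        ((fun t : ℝ => 2 * Complex.I * (t : ℂ)) '' Set.Ioo (Real.arccos x₀ - Real.pi) 0) ∧
      -- `g` maps `(x₀,1)` bijectively onto `(0, 2i·arccos x₀)`
      Set.BijOn g ((fun t : ℝ => (t : ℂ)) '' Set.Ioo x₀ 1)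
        ((fun t : ℝ => 2 * Complex.I * (t : ℂ)) '' Set.Ioo 0 (Real.arccos x₀)) := by
  set g : ℂ → ℂ := fun z =>
    2 * Complex.I * (Real.arccos x₀ : ℂ) - 2 * Complex.log (joukowskyInv z) with hgdef
  have hderiv : ∀ z ∈ cutPlane, HasDerivAt g (2 * Complex.I / sqrtOneSubSq z) z := by
    intro z hz
    exact (((hasDerivAt_log_joukowskyInv hz).const_mul 2).const_sub
      (2 * Complex.I * (Real.arccos x₀ : ℂ))).congr_deriv (by ring)
  have hdiff : DifferentiableOn ℂ g cutPlane := fun z hz =>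
    (hderiv z hz).differentiableAt.differentiableWithinAt
  have hval : ∀ x ∈ Set.Ioo (-1 : ℝ) 1,
      g (x : ℂ) = 2 * Complex.I * ((Real.arccos x₀ - Real.arccos x : ℝ) : ℂ) := by
    intro x hx
    simp only [hgdef, log_joukowskyInv_ofReal hx]
    push_cast
    ring
  have hd₀ : HasDerivAt g (2 * Complex.I / ((Real.sqrt (1 - x₀ ^ 2) : ℝ) : ℂ)) (x₀ : ℂ) := by
    rw [← sqrtOneSubSq_ofReal hx₀]
    exact hderiv _ (ofReal_mem_cutPlane hx₀)
  refine ⟨g, ?_, hdiff, hval, hd₀, ?_, ?_, ?_⟩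
  · intro z hz
    rcases hz.lt_or_gt with h | h
    · have hinv : z + s z = (joukowskyInv z)⁻¹ := by
        rw [branch_eq_of_im_neg hs hs2 hsinf h, ← sub_eq_add_neg]
        exact eq_inv_of_mul_eq_one_right (joukowskyInv_mul z)
      rw [hFdown z h, hinv, Complex.log_inv _
        (Complex.slitPlane_arg_ne_pi
          (joukowskyInv_mem_slitPlane (mem_cutPlane_of_im_ne_zero hz)))]
      simp only [hgdef]
      ring
    · rw [hFup z h, branch_eq_of_im_pos hs hs2 hsinf h]
      rfl
  · have h := isBigO_sub_sub_deriv_mul isOpen_cutPlane hdiff (ofReal_mem_cutPlane hx₀) hd₀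
    simpa [hval x₀ hx₀] using h
  · simpa using bijOn_of_eq_arccos (A := Real.arccos x₀) le_rfl hx₀.2.le hx₀.1.le
      fun x hx => hval x ⟨hx.1, hx.2.trans hx₀.2⟩
  · simpa using bijOn_of_eq_arccos (A := Real.arccos x₀) hx₀.1.le le_rfl hx₀.2.le
      fun x hx => hval x ⟨hx₀.1.trans hx.1, hx.2⟩
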